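/- Let n ≥ 1 and let (Ψ_π)_{π∈NC_n} be a family of wheel polynomials of order n satisfying Ψ_π(σ) = 1 if σ = π and Ψ_π(σ) = 0 if σ ≠ π, for all σ ∈ NC_n. Then every wheel polynomial p of order n satisfies p = Σ_{π∈NC_n} p(π)·Ψ_π; in particular the family (Ψ_π)_{π∈NC_n} is a basis of the ℂ-vector space of wheel polynomials of order n, with dual basis given by the π-evaluation functionals. -/

import Mathlib

open scoped BigOperators

open MvPolynomial

attribute [local instance 10] Classical.propDecidable

/-- A noncrossing matching of order `n`, on the points `0, …, 2n-1`
(representing the 1-indexed points `1, …, 2n`): a fixed-point-free involution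
with no crossing `a < b < c < d`, `f a = c`, `f b = d`. -/
structure NCM (n : ℕ) where
  f : Fin (2 * n) → Fin (2 * n)
  invol : ∀ k, f (f k) = k
  nofix : ∀ k, f k ≠ k
  noncross : ∀ a b c d : Fin (2 * n), a < b → b < c → c < d → f a = c → f b = d → False

theorem NCM.ext' {n : ℕ} {π σ : NCM n} (h : π.f = σ.f) : π = σ := by
  cases π; cases σ; simpa using h

noncomputable instance {n : ℕ} : Fintype (NCM n) :=
  Fintype.ofInjective NCM.f fun _ _ h => NCM.ext' h

/-- `q = e^{2πi/3}`. -/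
noncomputable def q : ℂ := Complex.exp (2 * Real.pi * Complex.I / 3)

/-- A wheel polynomial of order `n`: homogeneous of total degree `n(n-1)` and
vanishing under every substitution `z_j := q² z_i`, `z_k := q⁴ z_i` for `i < j < k`. -/
def IsWheel (n : ℕ) (p : MvPolynomial (Fin (2 * n)) ℂ) : Prop :=
  p.IsHomogeneous (n * (n - 1)) ∧
  ∀ i j k : Fin (2 * n), i < j → j < k →
    (aeval fun l : Fin (2 * n) =>
      if l = j then C (q ^ 2) * X i
      else if l = k then C (q ^ 4) * X i
      else (X l : MvPolynomial (Fin (2 * n)) ℂ)) p = 0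

/-- The `π`-evaluation `p(π) = p(q^{-π_1}, …, q^{-π_{2n}})`, where the `k`-th coordinate
is `q⁻¹` if `π` matches `k` to the right and `q` if it matches `k` to the left. -/
noncomputable def evalNC {n : ℕ} (p : MvPolynomial (Fin (2 * n)) ℂ) (π : NCM n) : ℂ :=
  eval (fun k => if k < π.f k then q⁻¹ else q) p

/-- Evaluation of a polynomial with all variables set to `1`. -/
noncomputable def evalOne {n : ℕ} (p : MvPolynomial (Fin (2 * n)) ℂ) : ℂ :=
  eval (fun _ => (1 : ℂ)) p

/-- The alternating sign matrix numbers `ASM(n) = ∏_{j=0}^{n-1} (3j+1)!/(n+j)!`. -/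
noncomputable def ASM (n : ℕ) : ℂ :=
  ∏ j ∈ Finset.range n, ((3 * j + 1).factorial : ℂ) / ((n + j).factorial : ℂ)

/-- Cyclic successor on `Fin m`. -/
def fsucc {m : ℕ} (k : Fin m) : Fin m := ⟨((k : ℕ) + 1) % m, Nat.mod_lt _ k.pos⟩

/-- The Temperley–Lieb operator `e_k` (underlying function on points): if `π` matches
`k` with `k+1` it is `π`; otherwise it matches `k ↔ k+1`, `π(k) ↔ π(k+1)` and agrees
with `π` elsewhere (indices cyclic modulo `2n`). -/
def eRaw {n : ℕ} (k : Fin (2 * n)) (π : NCM n) : Fin (2 * n) → Fin (2 * n) :=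
  if π.f k = fsucc k then π.f
  else fun m =>
    if m = k then fsucc k
    else if m = fsucc k then k
    else if m = π.f k then π.f (fsucc k)
    else if m = π.f (fsucc k) then π.f k
    else π.f m

/-- The stationarity linear system `2n·v_π = Σ_{k=1}^{2n} Σ_{π' : e_k(π') = π} v_{π'}`. -/
def Stationary {n : ℕ} (v : NCM n → ℂ) : Prop :=
  ∀ π : NCM n, ((2 * n : ℕ) : ℂ) * v π =
    ∑ k : Fin (2 * n), ∑ π' : NCM n, if eRaw k π' = π.f then v π' else 0


section WheelAux

theorem q_cube : q ^ 3 = 1 := by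
  unfold q
  rw [← Complex.exp_nat_mul]
  have : ((3 : ℕ) : ℂ) * (2 * Real.pi * Complex.I / 3) = 2 * Real.pi * Complex.I := by
    push_cast; ring
  rw [this, Complex.exp_two_pi_mul_I]

theorem q_ne_zero : q ≠ 0 := Complex.exp_ne_zero _

theorem q_ne_one : q ≠ 1 := by
  intro h
  unfold q at h
  rw [Complex.exp_eq_one_iff] at h
  obtain ⟨m, hm⟩ := h
  have h2 : (2 * Real.pi * Complex.I : ℂ) ≠ 0 := Complex.two_pi_I_ne_zero
  have h3 : (2 * Real.pi * Complex.I : ℂ) * (3 * (m : ℂ) - 1) = 0 := by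
    linear_combination -3 * hm
  have h4 : 3 * (m : ℂ) - 1 = 0 := (mul_eq_zero.mp h3).resolve_left h2
  have h5 : 3 * m - 1 = 0 := by exact_mod_cast h4
  omega

theorem q_sq_ne_one : q ^ 2 ≠ 1 := by
  intro h
  apply q_ne_one
  linear_combination q_cube - q * h

/-- The wheel condition, phrased through evaluations, for variables indexed by a linear order. -/
def WheelCond {ι : Type} [LinearOrder ι] (p : MvPolynomial ι ℂ) : Prop :=
  ∀ (z : ι → ℂ) (i j k : ι), i < j → j < k → z j = q ^ 2 * z i → z k = q ^ 4 * z i →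
    eval z p = 0

theorem eval_zero_of_line {ι : Type} (p : MvPolynomial ι ℂ) (z w : ι → ℂ) (S : Set ℂ)
    (hS : S.Finite) (h : ∀ t, t ∉ S → eval (fun l => z l + t * w l) p = 0) : eval z p = 0 := by
  set P : Polynomial ℂ :=
    aeval (fun l => Polynomial.C (z l) + Polynomial.X * Polynomial.C (w l)) p with hP
  have hev : ∀ t, P.eval t = eval (fun l => z l + t * w l) p := by
    intro t
    have h1 : P.eval t = (Polynomial.aeval t) P := by simp
    rw [h1, hP, ← MvPolynomial.aeval_eq_eval, ← AlgHom.comp_apply, MvPolynomial.comp_aeval,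
      MvPolynomial.aeval_eq_eval]
    congr 2
    ext l
    simp
    ring
  have h0 : P = 0 := by
    apply Polynomial.eq_zero_of_infinite_isRoot
    apply Set.Infinite.mono (s := Sᶜ) _ hS.infinite_compl
    intro t ht
    show P.eval t = 0
    rw [hev, h t ht]
  have := hev 0
  rw [h0] at this
  simpa using this.symm

theorem eval_sub_aeval {ι κ : Type} (p : MvPolynomial ι ℂ) (g : ι → MvPolynomial κ ℂ)
    (z : κ → ℂ) : eval z (aeval g p) = eval (fun l => eval z (g l)) p := by
  rw [← MvPolynomial.aeval_eq_eval, ← MvPolynomial.aeval_eq_eval, ← AlgHom.comp_apply,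
    MvPolynomial.comp_aeval]

theorem X_sub_dvd_iff {ι : Type} [DecidableEq ι] (j : ι) (g : MvPolynomial ι ℂ)
    (hg : ∀ z c, eval (Function.update z j c) g = eval z g) (P : MvPolynomial ι ℂ) :
    (X j - g) ∣ P ↔ ∀ z, z j = eval z g → eval z P = 0 := by
  constructor
  · rintro ⟨r, rfl⟩ z hz
    simp [hz]
  · intro h
    have h0 : aeval (Function.update X j g) P = 0 := by
      apply MvPolynomial.funext
      intro z
      rw [eval_sub_aeval, map_zero]
      have : (fun l => eval z (Function.update X j g l : MvPolynomial ι ℂ))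
          = Function.update z j (eval z g) := by
        ext l
        by_cases hl : l = j
        · subst hl; simp
        · simp [hl]
      rw [this]
      apply h
      simp [hg]
    rw [← Ideal.mem_span_singleton, ← Ideal.Quotient.eq_zero_iff_mem]
    set I := Ideal.span {(X j - g : MvPolynomial ι ℂ)} with hI
    have key : Ideal.Quotient.mkₐ ℂ I =
        (Ideal.Quotient.mkₐ ℂ I).comp (aeval (Function.update X j g)) := by
      apply MvPolynomial.algHom_ext
      intro l
      by_cases hl : l = j
      · subst hl
        simp only [Ideal.Quotient.mkₐ_eq_mk, AlgHom.comp_apply, aeval_X, Function.update_self]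
        rw [Ideal.Quotient.eq]
        exact Ideal.mem_span_singleton_self _
      · simp [hl]
    have := congrArg (fun φ => φ P) key
    simp only [AlgHom.comp_apply, h0, map_zero] at this
    exact this

theorem X_sub_prime {ι : Type} [DecidableEq ι] (j : ι) (g : MvPolynomial ι ℂ)
    (hg : ∀ z c, eval (Function.update z j c) g = eval z g) : Prime (X j - g) := by
  have hpt : ∀ z : ι → ℂ, ∃ z', z' j = eval z' g + 1 ∧ z' = Function.update z j (eval z g + 1) := by
    intro z
    exact ⟨_, by simp [hg], rfl⟩
  refine ⟨?_, ?_, ?_⟩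
  · intro h
    obtain ⟨z', h1, -⟩ := hpt 0
    have := congrArg (eval z') h
    simp [h1] at this
  · intro h
    have h1 := (X_sub_dvd_iff j g hg 1).1 h.dvd
    have := h1 (Function.update 0 j (eval 0 g)) (by simp [hg])
    simp at this
  · intro A B hAB
    by_contra hcon
    push Not at hcon
    obtain ⟨hA, hB⟩ := hcon
    have key : ∀ P : MvPolynomial ι ℂ, (X j - g) ∣ P ↔ aeval (Function.update X j g) P = 0 := by
      intro P
      rw [X_sub_dvd_iff j g hg]
      have e : ∀ z, (fun l => eval z (Function.update X j g l : MvPolynomial ι ℂ))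
          = Function.update z j (eval z g) := by
        intro z
        ext l
        by_cases hl : l = j
        · subst hl; simp
        · simp [hl]
      constructor
      · intro h
        apply MvPolynomial.funext
        intro z
        rw [eval_sub_aeval, map_zero, e]
        apply h
        simp [hg]
      · intro h z hz
        have := congrArg (eval z) h
        rw [eval_sub_aeval, map_zero, e, ← hz, Function.update_eq_self] at this
        exact this
    rw [key] at hA hB hAB
    rw [map_mul] at hAB
    exact (mul_ne_zero hA hB) hAB

theorem X_sub_totalDegree {ι : Type} [DecidableEq ι] (j : ι) (g : MvPolynomial ι ℂ)
    (hg : ∀ z c, eval (Function.update z j c) g = eval z g) : 1 ≤ (X j - g).totalDegree := by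
  by_contra h
  have h0 : (X j - g).totalDegree = 0 := by omega
  rw [totalDegree_eq_zero_iff_eq_C] at h0
  have h1 := congrArg (eval (Function.update 0 j 0)) h0
  have h2 := congrArg (eval (Function.update 0 j 1)) h0
  simp only [map_sub, eval_X, Function.update_self, hg, eval_C] at h1 h2
  rw [← h1] at h2
  simp at h2

theorem card_add_le_totalDegree {ι κ : Type} (s : Finset κ) (L : κ → MvPolynomial ι ℂ)
    (hL : ∀ a ∈ s, 1 ≤ (L a).totalDegree) (r : MvPolynomial ι ℂ) (hr : r ≠ 0) :
    r.totalDegree + s.card ≤ ((∏ a ∈ s, L a) * r).totalDegree ∧ (∏ a ∈ s, L a) * r ≠ 0 := by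
  classical
  induction s using Finset.induction_on with
  | empty => simp [hr]
  | insert a s ha ih =>
    obtain ⟨h1, h2⟩ := ih (fun b hb => hL b (Finset.mem_insert_of_mem hb))
    have h3 := hL a (Finset.mem_insert_self _ _)
    have h4 : L a ≠ 0 := by
      intro h; rw [h] at h3; simp at h3
    rw [Finset.prod_insert ha, mul_assoc, Finset.card_insert_of_notMem ha]
    refine ⟨?_, mul_ne_zero h4 h2⟩
    rw [totalDegree_mul_of_isDomain h4 h2]
    omega

theorem prod_X_sub_dvd {ι κ : Type} [DecidableEq ι] (s : Finset κ) (j : κ → ι)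
    (g : κ → MvPolynomial ι ℂ)
    (hg : ∀ a ∈ s, ∀ z c, eval (Function.update z (j a) c) (g a) = eval z (g a))
    (hne : ∀ a ∈ s, ∀ b ∈ s, a ≠ b → ∃ z, z (j a) = eval z (g a) ∧ z (j b) ≠ eval z (g b))
    (P : MvPolynomial ι ℂ)
    (hP : ∀ a ∈ s, ∀ z, z (j a) = eval z (g a) → eval z P = 0) :
    (∏ a ∈ s, (X (j a) - g a)) ∣ P := by
  apply Finset.prod_dvd_of_isRelPrime
  · intro a ha b hb hab
    have hp := (X_sub_prime (j a) (g a) (hg a ha)).irreducible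
    show IsRelPrime (X (j a) - g a) (X (j b) - g b)
    rw [hp.isRelPrime_iff_not_dvd, X_sub_dvd_iff _ _ (hg a ha)]
    intro h
    obtain ⟨z, h1, h2⟩ := hne a ha b hb hab
    have := h z h1
    simp only [map_sub, eval_X, sub_eq_zero] at this
    exact h2 this
  · intro a ha
    exact (X_sub_dvd_iff _ _ (hg a ha) P).2 (hP a ha)

theorem totalDegree_aeval_le {ι κ : Type} (p : MvPolynomial ι ℂ) (g : ι → MvPolynomial κ ℂ)
    (hg : ∀ l, (g l).totalDegree ≤ 1) : (aeval g p).totalDegree ≤ p.totalDegree := by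
  rw [aeval_def, eval₂_eq]
  apply totalDegree_finsetSum_le
  intro d hd
  refine (totalDegree_mul _ _).trans ?_
  rw [MvPolynomial.algebraMap_eq, totalDegree_C, zero_add]
  refine (totalDegree_finsetProd _ _).trans ?_
  refine le_trans ?_ (le_totalDegree hd)
  apply Finset.sum_le_sum
  intro i _
  refine (totalDegree_pow _ _).trans ?_
  simpa using Nat.mul_le_mul_left (d i) (hg i)

theorem eval_scale {ι : Type} {m : ℕ} (p : MvPolynomial ι ℂ) (hp : p.IsHomogeneous m) (t : ℂ)
    (z : ι → ℂ) : eval (fun l => t * z l) p = t ^ m * eval z p := by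
  rw [eval_eq, eval_eq, Finset.mul_sum]
  apply Finset.sum_congr rfl
  intro d hd
  have hdeg := hp (mem_support_iff.1 hd)
  simp only [mul_pow, Finset.prod_mul_distrib]
  rw [Finset.prod_pow_eq_pow_sum]
  have : ∑ i ∈ d.support, d i = m := by
    rw [← hdeg]; simp [Finsupp.weight_apply, Finsupp.sum]
  rw [this]; ring

theorem wheelCond_homogeneousComponent {ι : Type} [LinearOrder ι] (p : MvPolynomial ι ℂ)
    (hp : WheelCond p) (m : ℕ) : WheelCond (homogeneousComponent m p) := by
  intro z i j k hij hjk h1 h2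
  by_cases hm : p.totalDegree < m
  · rw [homogeneousComponent_eq_zero _ _ hm]; simp
  set Q : Polynomial ℂ := ∑ e ∈ Finset.range (p.totalDegree + 1),
    Polynomial.C (eval z (homogeneousComponent e p)) * Polynomial.X ^ e with hQ
  have h0 : Q = 0 := by
    apply Polynomial.funext
    intro t
    have h3 : eval (fun l => t * z l) p = 0 :=
      hp _ i j k hij hjk (by simp only [h1]; ring) (by simp only [h2]; ring)
    rw [← sum_homogeneousComponent p, map_sum] at h3
    rw [hQ, Polynomial.eval_finsetSum, Polynomial.eval_zero, ← h3]
    apply Finset.sum_congr rfl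
    intro e _
    rw [eval_scale _ (homogeneousComponent_isHomogeneous e p)]
    rw [Polynomial.eval_mul, Polynomial.eval_C, Polynomial.eval_pow, Polynomial.eval_X, mul_comm]
  have := congrArg (fun R => Polynomial.coeff R m) h0
  simp only [hQ, Polynomial.finsetSum_coeff, Polynomial.coeff_C_mul_X_pow,
    Polynomial.coeff_zero] at this
  rw [Finset.sum_ite_eq] at this
  rw [if_pos (by simp; omega)] at this
  exact this

/-- The remaining variables once `i` and `j` are removed. -/
abbrev Rem {ι : Type} (i j : ι) : Type := {k : ι // k ≠ i ∧ k ≠ j}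

theorem card_Rem {ι : Type} [Fintype ι] [DecidableEq ι] (i j : ι) (hij : i ≠ j) :
    Fintype.card (Rem i j) + 2 = Fintype.card ι := by
  rw [Fintype.card_subtype]
  have h : (Finset.univ.filter fun k : ι => k ≠ i ∧ k ≠ j) = Finset.univ \ {i, j} := by
    ext k; simp
  rw [h, Finset.card_sdiff_of_subset (Finset.subset_univ _), Finset.card_pair hij,
    Finset.card_univ]
  have : 2 ≤ Fintype.card ι := by
    rw [← Finset.card_pair hij]; exact Finset.card_le_univ _
  omega

/-- Extend a point by the values `a` at `i` and `q² a` at `j`. -/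
noncomputable def extPt {ι : Type} [DecidableEq ι] (i j : ι) (a : ℂ) (z : Rem i j → ℂ) : ι → ℂ :=
  fun l => if h : l ≠ i ∧ l ≠ j then z ⟨l, h⟩ else if l = i then a else q ^ 2 * a

theorem extPt_left {ι : Type} [DecidableEq ι] (i j : ι) (a : ℂ) (z : Rem i j → ℂ) :
    extPt i j a z i = a := by simp [extPt]

theorem extPt_right {ι : Type} [DecidableEq ι] (i j : ι) (hij : i ≠ j) (a : ℂ)
    (z : Rem i j → ℂ) : extPt i j a z j = q ^ 2 * a := by simp [extPt, hij.symm]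

theorem extPt_val {ι : Type} [DecidableEq ι] (i j : ι) (a : ℂ) (z : Rem i j → ℂ)
    (k : Rem i j) : extPt i j a z k.1 = z k := by
  simp [extPt, k.2.1, k.2.2]

theorem extPt_restrict {ι : Type} [DecidableEq ι] (i j : ι) (a : ℂ) (z : ι → ℂ)
    (h1 : z i = a) (h2 : z j = q ^ 2 * a) : extPt i j a (fun k : Rem i j => z k.1) = z := by
  ext l
  unfold extPt
  split_ifs with h h'
  · rfl
  · rw [h', h1]
  · have : l = j := by tauto
    rw [this, h2]

theorem step_factor {ι : Type} [Fintype ι] [LinearOrder ι] (p : MvPolynomial ι ℂ)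
    (hp : WheelCond p) (i j : ι) (hij : i < j) (a : ℂ) (T : Finset (Rem i j × ℂ))
    (hT : ∀ x ∈ T, ∀ z : ι → ℂ, z i = a → z j = q ^ 2 * a → z x.1.1 = x.2 → eval z p = 0) :
    ∃ r : MvPolynomial (Rem i j) ℂ, WheelCond r ∧
      (r = 0 ∨ r.totalDegree + T.card ≤ p.totalDegree) ∧
      ∀ z : Rem i j → ℂ, eval (extPt i j a z) p = (∏ x ∈ T, (z x.1 - x.2)) * eval z r := by
  set G : ι → MvPolynomial (Rem i j) ℂ := fun l =>
    if h : l ≠ i ∧ l ≠ j then X ⟨l, h⟩ else if l = i then C a else C (q ^ 2 * a) with hG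
  have hGev : ∀ z : Rem i j → ℂ, eval z (aeval G p) = eval (extPt i j a z) p := by
    intro z
    rw [eval_sub_aeval]
    congr 2
    ext l
    simp only [hG, extPt]
    split_ifs <;> simp
  have hdeg : (aeval G p).totalDegree ≤ p.totalDegree := by
    apply totalDegree_aeval_le
    intro l
    simp only [hG]
    split_ifs
    · rw [totalDegree_X]
    · rw [totalDegree_C]; omega
    · rw [totalDegree_C]; omega
  have hg : ∀ x ∈ T, ∀ (z : Rem i j → ℂ) (c : ℂ),
      eval (Function.update z x.1 c) (C x.2 : MvPolynomial (Rem i j) ℂ)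
        = eval z (C x.2 : MvPolynomial (Rem i j) ℂ) := by
    intro x _ z c
    rw [eval_C, eval_C]
  have hdvd : (∏ x ∈ T, (X x.1 - C x.2 : MvPolynomial (Rem i j) ℂ)) ∣ aeval G p := by
    apply prod_X_sub_dvd T (fun x => x.1) (fun x => C x.2) hg
    · intro x _ y _ hxy
      by_cases h1 : x.1 = y.1
      · refine ⟨fun _ => x.2, by simp, ?_⟩
        simp only [eval_C]
        intro h2
        exact hxy (Prod.ext h1 h2)
      · refine ⟨Function.update (fun _ => y.2 + 1) x.1 x.2, by simp, ?_⟩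
        rw [Function.update_of_ne (Ne.symm h1)]
        simp
    · intro x hx z hz
      rw [hGev]
      apply hT x hx _ (extPt_left _ _ _ _) (extPt_right _ _ hij.ne _ _)
      rw [extPt_val, hz, eval_C]
  obtain ⟨r, hr⟩ := hdvd
  have hrev : ∀ z : Rem i j → ℂ,
      eval (extPt i j a z) p = (∏ x ∈ T, (z x.1 - x.2)) * eval z r := by
    intro z
    rw [← hGev, hr, map_mul, map_prod]
    simp
  refine ⟨r, ?_, ?_, hrev⟩
  · intro z i' j' k' hij' hjk' h1 h2
    set w : Rem i j → ℂ := fun l => if l = j' then q ^ 2 else if l = k' then q ^ 4 else 1 with hw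
    have hw0 : ∀ l, w l ≠ 0 := by
      intro l
      simp only [hw]
      split_ifs
      · exact pow_ne_zero _ q_ne_zero
      · exact pow_ne_zero _ q_ne_zero
      · exact one_ne_zero
    have hwi : w i' = 1 := by simp [hw, hij'.ne, (hij'.trans hjk').ne]
    have hwj : w j' = q ^ 2 := by simp [hw]
    have hwk : w k' = q ^ 4 := by simp [hw, hjk'.ne']
    apply eval_zero_of_line r z w ((T.image fun x => (x.2 - z x.1) / w x.1 : Finset ℂ) : Set ℂ)
      (Finset.finite_toSet _)
    intro t ht
    have h3 := hrev (fun l => z l + t * w l)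
    have h4 : eval (extPt i j a (fun l => z l + t * w l)) p = 0 := by
      apply hp _ i'.1 j'.1 k'.1 hij' hjk'
      · rw [extPt_val, extPt_val, h1, hwi, hwj]; ring
      · rw [extPt_val, extPt_val, h2, hwi, hwk]; ring
    rw [h4] at h3
    refine (mul_eq_zero.mp h3.symm).resolve_left ?_
    apply Finset.prod_ne_zero_iff.2
    intro x hx h5
    apply ht
    rw [Finset.mem_coe, Finset.mem_image]
    refine ⟨x, hx, ?_⟩
    rw [div_eq_iff (hw0 _)]
    linear_combination -h5
  · by_cases hr0 : r = 0
    · exact Or.inl hr0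
    · right
      have := (card_add_le_totalDegree T (fun x => (X x.1 - C x.2 : MvPolynomial (Rem i j) ℂ))
        (fun x hx => X_sub_totalDegree _ _ (hg x hx)) r hr0).1
      rw [← hr] at this
      exact this.trans hdeg

/-- `p` vanishes on the hyperplane `z_j = q² z_i`. -/
def VanH {ι : Type} (p : MvPolynomial ι ℂ) (i j : ι) : Prop :=
  ∀ z : ι → ℂ, z j = q ^ 2 * z i → eval z p = 0

theorem vanH_of_ne_zero {ι : Type} [DecidableEq ι] (p : MvPolynomial ι ℂ) (i j : ι) (hij : i ≠ j)
    (h : ∀ z : ι → ℂ, z i ≠ 0 → z j = q ^ 2 * z i → eval z p = 0) : VanH p i j := by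
  intro z hz
  apply eval_zero_of_line p z (fun l => if l = i then 1 else if l = j then q ^ 2 else 0) {-z i}
    (Set.finite_singleton _)
  intro t ht
  apply h
  · simp only [if_true, mul_one]
    intro h0
    apply ht
    rw [Set.mem_singleton_iff]
    linear_combination h0
  · simp only [if_true, hij.symm, if_false, hz]; ring

theorem wheel_outside {ι : Type} [LinearOrder ι] (p : MvPolynomial ι ℂ)
    (hp : WheelCond p) (i j k : ι) (hij : i < j) (hk : k < i ∨ j < k) (a : ℂ) (z : ι → ℂ)
    (h1 : z i = a) (h2 : z j = q ^ 2 * a) (h3 : z k = q * a) : eval z p = 0 := by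
  rcases hk with hk | hk
  · apply hp z k i j hk hij
    · rw [h1, h3]; linear_combination -a * q_cube
    · rw [h2, h3]; linear_combination -a * q ^ 2 * q_cube
  · apply hp z i j k hij hk
    · rw [h1, h2]
    · rw [h1, h3]; linear_combination -a * q * q_cube

theorem outside_of_not_between {ι : Type} [LinearOrder ι] {i j k : ι} (h1 : k ≠ i) (h2 : k ≠ j)
    (h : ¬ (i < k ∧ k < j)) : k < i ∨ j < k := by
  rcases lt_or_gt_of_ne h1 with h3 | h3
  · exact Or.inl h3
  · right
    rcases lt_or_gt_of_ne h2 with h4 | h4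
    · exact absurd ⟨h3, h4⟩ h
    · exact h4

theorem eq_zero_of_vanH {ι : Type} [Fintype ι] [LinearOrder ι] (n : ℕ)
    (hc : Fintype.card ι = 2 * (n + 1)) (p : MvPolynomial ι ℂ)
    (hd : p.totalDegree ≤ (n + 1) * n) (h : ∀ i j, i < j → VanH p i j) : p = 0 := by
  by_contra hp0
  set s : Finset (ι × ι) := Finset.univ.filter fun x => x.1 < x.2 with hs
  have hcard : s.card * 2 = (2 * (n + 1)) * (2 * n + 1) := by
    have e1 : (Finset.univ : Finset ι).offDiag
        = s ∪ Finset.univ.filter fun x : ι × ι => x.2 < x.1 := by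
      ext x
      simp [hs, lt_or_lt_iff_ne]
    have e2 : (Finset.univ.filter fun x : ι × ι => x.2 < x.1).card = s.card := by
      apply Finset.card_bij (fun x _ => (x.2, x.1))
      · intro x hx; simpa [hs] using hx
      · rintro ⟨x1, x2⟩ _ ⟨y1, y2⟩ _ hxy
        simp only [Prod.mk.injEq] at hxy ⊢
        exact ⟨hxy.2, hxy.1⟩
      · rintro ⟨x1, x2⟩ hx
        refine ⟨(x2, x1), ?_, rfl⟩
        simpa [hs] using hx
    have e3 := Finset.offDiag_card (Finset.univ : Finset ι)
    rw [e1, Finset.card_union_of_disjoint, e2, Finset.card_univ, hc] at e3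
    · rw [mul_two, e3]
      have : (2 * (n + 1)) * (2 * (n + 1)) = (2 * (n + 1)) * (2 * n + 1) + 2 * (n + 1) := by ring
      omega
    · rw [Finset.disjoint_filter]
      intro x _ h1 h2
      exact lt_asymm h1 h2
  have hg : ∀ x ∈ s, ∀ (z : ι → ℂ) (c : ℂ),
      eval (Function.update z x.2 c) (C (q ^ 2) * X x.1 : MvPolynomial ι ℂ)
        = eval z (C (q ^ 2) * X x.1 : MvPolynomial ι ℂ) := by
    intro x hx z c
    have hx' : x.1 < x.2 := by simpa [hs] using hx
    simp [hx'.ne]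
  have hq2 : q ^ 2 ≠ 0 := pow_ne_zero _ q_ne_zero
  have hdvd : (∏ x ∈ s, (X x.2 - C (q ^ 2) * X x.1 : MvPolynomial ι ℂ)) ∣ p := by
    apply prod_X_sub_dvd s (fun x => x.2) (fun x => C (q ^ 2) * X x.1) hg
    · rintro ⟨i, j⟩ hx ⟨i', j'⟩ hy hxy
      have hij : i < j := by simpa [hs] using hx
      have hij' : i' < j' := by simpa [hs] using hy
      simp only [map_mul, eval_C, eval_X]
      by_cases h1 : j' = j
      · subst h1
        have h2 : i ≠ i' := fun h => hxy (by rw [h])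
        refine ⟨Pi.single i' 1, ?_, ?_⟩
        · simp [hij'.ne', h2]
        · simpa [hij'.ne'] using hq2.symm
      · by_cases h2 : j' = i
        · subst h2
          have h3 : j ≠ i' := (hij'.trans hij).ne'
          refine ⟨Pi.single i' 1, ?_, ?_⟩
          · simp [h3, hij'.ne']
          · simpa [hij'.ne'] using hq2.symm
        · refine ⟨Pi.single j' 1, ?_, ?_⟩
          · simp [Ne.symm h1, Ne.symm h2]
          · simp [hij'.ne]
    · intro x hx z hz
      apply h x.1 x.2 (by simpa [hs] using hx) z
      simpa using hz
  obtain ⟨r, hr⟩ := hdvd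
  have hr0 : r ≠ 0 := by
    rintro rfl
    exact hp0 (by rw [hr, mul_zero])
  have := (card_add_le_totalDegree s (fun x => (X x.2 - C (q ^ 2) * X x.1 : MvPolynomial ι ℂ))
    (fun x hx => X_sub_totalDegree _ _ (hg x hx)) r hr0).1
  rw [← hr] at this
  nlinarith

/-- Low degree wheel polynomials in `2n` variables vanish. -/
def LowDeg (n : ℕ) : Prop :=
  ∀ (ι : Type) [Fintype ι] [LinearOrder ι], Fintype.card ι = 2 * n →
    ∀ p : MvPolynomial ι ℂ, WheelCond p → p.totalDegree < n * (n - 1) → p = 0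

theorem eq_zero_of_adjacent (n : ℕ) (hlow : LowDeg n) {ι : Type} [Fintype ι] [LinearOrder ι]
    (hc : Fintype.card ι = 2 * (n + 1)) (p : MvPolynomial ι ℂ) (hp : WheelCond p)
    (hd : p.totalDegree ≤ (n + 1) * n)
    (hadj : ∀ i j, i < j → (∀ k, ¬ (i < k ∧ k < j)) → VanH p i j) : p = 0 := by
  apply eq_zero_of_vanH n hc p hd
  have key : ∀ N : ℕ, ∀ i j, i < j →
      (Finset.univ.filter fun k => i < k ∧ k < j).card = N → VanH p i j := by
    intro N
    induction N using Nat.strong_induction_on with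
    | _ N ih =>
    intro i j hij hN
    by_cases hk : ∀ k, ¬ (i < k ∧ k < j)
    · exact hadj i j hij hk
    push Not at hk
    obtain ⟨k0, hik0, hk0j⟩ := hk
    apply vanH_of_ne_zero p i j hij.ne
    intro z hzi hzj
    set a := z i with ha
    have hsub : ∀ k, i < k → k < j → VanH p i k ∧ VanH p k j := by
      intro k h1 h2
      constructor
      · refine ih _ ?_ i k h1 rfl
        rw [← hN]
        apply Finset.card_lt_card
        rw [Finset.ssubset_iff_of_subset]
        · exact ⟨k, by simp [h1, h2], by simp⟩
        · intro l hl
          simp only [Finset.mem_filter, Finset.mem_univ, true_and] at hl ⊢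
          exact ⟨hl.1, hl.2.trans h2⟩
      · refine ih _ ?_ k j h2 rfl
        rw [← hN]
        apply Finset.card_lt_card
        rw [Finset.ssubset_iff_of_subset]
        · exact ⟨k, by simp [h1, h2], by simp⟩
        · intro l hl
          simp only [Finset.mem_filter, Finset.mem_univ, true_and] at hl ⊢
          exact ⟨h1.trans hl.1, hl.2⟩
    set T0 : Finset (Rem i j × ℂ) := Finset.univ.image
      (fun k : Rem i j => (k, if i < k.1 ∧ k.1 < j then q ^ 2 * a else q * a)) with hT0
    set k0' : Rem i j := ⟨k0, hik0.ne', hk0j.ne⟩ with hk0'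
    have hT0c : T0.card = 2 * n := by
      rw [hT0, Finset.card_image_of_injective, Finset.card_univ]
      · have := card_Rem i j hij.ne
        omega
      · intro x y hxy
        exact (Prod.ext_iff.1 hxy).1
    have hnot : (k0', a) ∉ T0 := by
      rw [hT0, Finset.mem_image]
      rintro ⟨k, -, hk⟩
      rw [Prod.ext_iff] at hk
      obtain ⟨h1, h2⟩ := hk
      simp only at h1 h2
      subst h1
      rw [if_pos ⟨hik0, hk0j⟩] at h2
      apply q_sq_ne_one
      apply mul_right_cancel₀ hzi
      rw [h2, one_mul]
    obtain ⟨r, hrW, hrd, hrev⟩ := step_factor p hp i j hij a (insert (k0', a) T0) (by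
      intro x hx y h1 h2 h3
      rw [Finset.mem_insert] at hx
      rcases hx with rfl | hx
      · apply (hsub k0 hik0 hk0j).2
        simp only [hk0'] at h3
        rw [h2, h3]
      · rw [hT0, Finset.mem_image] at hx
        obtain ⟨k, -, rfl⟩ := hx
        simp only at h3
        split_ifs at h3 with hb
        · apply (hsub k.1 hb.1 hb.2).1
          rw [h1, h3]
        · exact wheel_outside p hp i j k.1 hij (outside_of_not_between k.2.1 k.2.2 hb) a y h1 h2 h3)
    have hr0 : r = 0 := by
      rcases hrd with hrd | hrd
      · exact hrd
      · apply hlow (Rem i j) (by have := card_Rem i j hij.ne; omega) r hrW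
        rw [Finset.card_insert_of_notMem hnot, hT0c] at hrd
        have h5 : r.totalDegree + (2 * n + 1) ≤ (n + 1) * n := hrd.trans hd
        cases n with
        | zero => omega
        | succ m =>
          simp only [Nat.add_sub_cancel]
          nlinarith
    have := hrev (fun k => z k.1)
    rw [extPt_restrict i j a z rfl hzj, hr0, map_zero, mul_zero] at this
    exact this
  intro i j hij
  exact key _ i j hij rfl

/-- The basic factorization for adjacent indices. -/
theorem step_adjacent (n : ℕ) {ι : Type} [Fintype ι] [LinearOrder ι]
    (hc : Fintype.card ι = 2 * (n + 1)) (p : MvPolynomial ι ℂ) (hp : WheelCond p)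
    (i j : ι) (hij : i < j) (hadj : ∀ k, ¬ (i < k ∧ k < j)) (a : ℂ) :
    ∃ r : MvPolynomial (Rem i j) ℂ, WheelCond r ∧
      (r = 0 ∨ r.totalDegree + 2 * n ≤ p.totalDegree) ∧
      ∀ z : Rem i j → ℂ, eval (extPt i j a z) p = (∏ k, (z k - q * a)) * eval z r := by
  set T0 : Finset (Rem i j × ℂ) := Finset.univ.image
    (fun k : Rem i j => (k, q * a)) with hT0
  have hinj : Function.Injective (fun k : Rem i j => (k, q * a)) := by
    intro x y hxy
    exact (Prod.ext_iff.1 hxy).1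
  have hT0c : T0.card = 2 * n := by
    rw [hT0, Finset.card_image_of_injective _ hinj, Finset.card_univ]
    have := card_Rem i j hij.ne
    omega
  obtain ⟨r, h1, h2, h3⟩ := step_factor p hp i j hij a T0 (by
    intro x hx y h1 h2 h3
    rw [hT0, Finset.mem_image] at hx
    obtain ⟨k, -, rfl⟩ := hx
    exact wheel_outside p hp i j k.1 hij (outside_of_not_between k.2.1 k.2.2 (hadj _)) a y h1 h2 h3)
  refine ⟨r, h1, ?_, ?_⟩
  · rw [hT0c] at h2
    exact h2
  · intro z
    rw [h3, hT0, Finset.prod_image (fun x _ y _ h => hinj h)]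

theorem lowDeg (n : ℕ) : LowDeg n := by
  induction n with
  | zero =>
    intro ι _ _ _ p _ hd
    omega
  | succ n ih =>
    intro ι _ _ hc p hp hd
    rw [Nat.add_sub_cancel] at hd
    apply eq_zero_of_adjacent n ih hc p hp hd.le
    intro i j hij hadj z hz
    obtain ⟨r, hrW, hrd, hrev⟩ := step_adjacent n hc p hp i j hij hadj (z i)
    have hr0 : r = 0 := by
      rcases hrd with hrd | hrd
      · exact hrd
      · apply ih (Rem i j) (by have := card_Rem i j hij.ne; omega) r hrW
        cases n with
        | zero => omega
        | succ m =>
          simp only [Nat.add_sub_cancel]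
          nlinarith
    have := hrev (fun k => z k.1)
    rw [extPt_restrict i j (z i) z rfl hz, hr0, map_zero, mul_zero] at this
    exact this

theorem homogeneous_of_wheel (n : ℕ) {ι : Type} [Fintype ι] [LinearOrder ι]
    (hc : Fintype.card ι = 2 * n) (p : MvPolynomial ι ℂ) (hp : WheelCond p)
    (hd : p.totalDegree ≤ n * (n - 1)) : p.IsHomogeneous (n * (n - 1)) := by
  have h0 : ∀ m, m < n * (n - 1) → homogeneousComponent m p = 0 := by
    intro m hm
    apply lowDeg n ι hc _ (wheelCond_homogeneousComponent p hp m)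
    exact lt_of_le_of_lt (homogeneousComponent_isHomogeneous m p).totalDegree_le hm
  rw [← sum_homogeneousComponent p]
  apply IsHomogeneous.sum
  intro m hm
  rcases lt_or_ge m (n * (n - 1)) with h | h
  · rw [h0 m h]; exact isHomogeneous_zero _ _ _
  · have : m = n * (n - 1) := by
      rw [Finset.mem_range] at hm; omega
    rw [this]
    exact homogeneousComponent_isHomogeneous _ _

theorem eq_zero_of_matchings (n : ℕ) : ∀ (ι : Type) [Fintype ι] [LinearOrder ι],
    Fintype.card ι = 2 * n → ∀ p : MvPolynomial ι ℂ, WheelCond p →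
    p.totalDegree ≤ n * (n - 1) →
    (∀ f : ι → ι, (∀ k, f (f k) = k) → (∀ k, f k ≠ k) →
      (∀ a b c d : ι, a < b → b < c → c < d → f a = c → f b = d → False) →
      eval (fun k => if k < f k then q⁻¹ else q) p = 0) → p = 0 := by
  induction n with
  | zero =>
    intro ι _ _ hc p _ _ h
    have hE : IsEmpty ι := Fintype.card_eq_zero_iff.1 (by simpa using hc)
    have h1 := h id (fun k => rfl) (fun k => hE.elim k) (fun a => hE.elim a)
    apply MvPolynomial.funext
    intro z
    rw [map_zero, ← h1]
    congr 2
    ext k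
    exact hE.elim k
  | succ n ih =>
    intro ι _ _ hc p hp hd h
    have hom := homogeneous_of_wheel (n + 1) hc p hp hd
    rw [Nat.add_sub_cancel] at hd
    apply eq_zero_of_adjacent n (lowDeg n) hc p hp hd
    intro i j hij hadj
    obtain ⟨r, hrW, hrd, hrev⟩ := step_adjacent n hc p hp i j hij hadj q⁻¹
    have hr0 : r = 0 := by
      rcases hrd with hrd | hrd
      · exact hrd
      apply ih (Rem i j) (by have := card_Rem i j hij.ne; omega) r hrW
      · cases n with
        | zero => simp only [zero_mul] ; omega
        | succ m =>
          simp only [Nat.add_sub_cancel]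
          nlinarith
      · intro f hf1 hf2 hf3
        set F : ι → ι := fun l =>
          if hl : l ≠ i ∧ l ≠ j then (f ⟨l, hl⟩).1 else if l = i then j else i with hF
        have hFi : F i = j := by simp [hF]
        have hFj : F j = i := by simp [hF, hij.ne']
        have hFv : ∀ k : Rem i j, F k.1 = (f k).1 := by
          intro k
          simp [hF, k.2.1, k.2.2]
        have hcases : ∀ l : ι, l = i ∨ l = j ∨ ∃ k : Rem i j, k.1 = l := by
          intro l
          by_cases h1 : l = i
          · exact Or.inl h1
          by_cases h2 : l = j
          · exact Or.inr (Or.inl h2)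
          · exact Or.inr (Or.inr ⟨⟨l, h1, h2⟩, rfl⟩)
        have hzero := h F (by
          intro l
          rcases hcases l with rfl | rfl | ⟨k, rfl⟩
          · rw [hFi, hFj]
          · rw [hFj, hFi]
          · rw [hFv, hFv, hf1]) (by
          intro l
          rcases hcases l with rfl | rfl | ⟨k, rfl⟩
          · rw [hFi]; exact hij.ne'
          · rw [hFj]; exact hij.ne
          · rw [hFv]
            intro h'
            exact hf2 k (Subtype.ext h')) (by
          intro a b c d hab hbc hcd hac hbd
          rcases hcases a with rfl | rfl | ⟨a, rfl⟩
          · rw [hFi] at hac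
            subst hac
            exact hadj b ⟨hab, hbc⟩
          · rw [hFj] at hac
            subst hac
            exact lt_asymm hij (hab.trans hbc)
          rcases hcases b with rfl | rfl | ⟨b, rfl⟩
          · rw [hFi] at hbd
            subst hbd
            exact hadj c ⟨hbc, hcd⟩
          · rw [hFj] at hbd
            subst hbd
            exact lt_asymm hij (hbc.trans hcd)
          rw [hFv] at hac hbd
          subst hac hbd
          exact hf3 a b (f a) (f b) hab hbc hcd rfl rfl)
        have hpt : (fun k => if k < F k then q⁻¹ else q)
            = extPt i j q⁻¹ (fun k => if k < f k then q⁻¹ else q) := by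
          ext l
          rcases hcases l with rfl | rfl | ⟨k, rfl⟩
          · rw [extPt_left, hFi, if_pos hij]
          · rw [extPt_right _ _ hij.ne, hFj, if_neg hij.not_gt]
            field_simp [q_ne_zero]
          · rw [extPt_val, hFv]
            rfl
        rw [hpt, hrev] at hzero
        refine (mul_eq_zero.mp hzero).resolve_left ?_
        apply Finset.prod_ne_zero_iff.2
        intro k _ h0
        rw [mul_inv_cancel₀ q_ne_zero, sub_eq_zero] at h0
        split_ifs at h0
        · exact q_ne_one (inv_eq_one.mp h0)
        · exact q_ne_one h0
    apply vanH_of_ne_zero p i j hij.ne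
    intro z hzi hzj
    have hc0 : z i * q ≠ 0 := mul_ne_zero hzi q_ne_zero
    have e : z = fun l => (z i * q) * ((z i * q)⁻¹ * z l) := by
      ext l
      rw [← mul_assoc, mul_inv_cancel₀ hc0, one_mul]
    rw [e, eval_scale p hom]
    have := hrev (fun k => (z i * q)⁻¹ * z k.1)
    rw [extPt_restrict i j q⁻¹ (fun l => (z i * q)⁻¹ * z l), hr0, map_zero, mul_zero] at this
    · rw [this, mul_zero]
    · rw [mul_inv]
      field_simp
    · rw [hzj, mul_inv]
      field_simp

theorem wheelCond_of_isWheel (n : ℕ) (p : MvPolynomial (Fin (2 * n)) ℂ) (hp : IsWheel n p) :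
    WheelCond p := by
  intro z i j k hij hjk h1 h2
  have h := congrArg (eval z) (hp.2 i j k hij hjk)
  rw [eval_sub_aeval, map_zero] at h
  rw [← h]
  congr 2
  ext l
  split_ifs with h3 h4
  · subst h3; simp [h1]
  · subst h4; simp [h2]
  · simp

end WheelAux

/-- The qKZ polynomials form a basis: every wheel polynomial `p` satisfies
`p = Σ_π p(π) • Ψ_π`, and the family `(Ψ_π)` is linearly independent. -/
theorem qKZ_basis_expansion (n : ℕ) (hn : 1 ≤ n)
    (Ψ : NCM n → MvPolynomial (Fin (2 * n)) ℂ)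
    (hwheel : ∀ π, IsWheel n (Ψ π))
    (hdual : ∀ π σ : NCM n, evalNC (Ψ π) σ = if σ = π then 1 else 0) :
    (∀ p : MvPolynomial (Fin (2 * n)) ℂ, IsWheel n p →
      p = ∑ π : NCM n, evalNC p π • Ψ π) ∧
    LinearIndependent ℂ Ψ := by
  have hsum : ∀ (c : NCM n → ℂ) (σ : NCM n), evalNC (∑ π, c π • Ψ π) σ = c σ := by
    intro c σ
    have h1 : evalNC (∑ π, c π • Ψ π) σ = ∑ π, c π * evalNC (Ψ π) σ := by
      simp only [evalNC, map_sum, smul_eval]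
    rw [h1]
    simp only [hdual, mul_ite, mul_one, mul_zero]
    simp
  constructor
  · intro p hp
    rw [← sub_eq_zero]
    set s := ∑ π : NCM n, evalNC p π • Ψ π with hs
    have hsW : WheelCond s := by
      intro z i j k hij hjk h1 h2
      rw [hs, map_sum]
      apply Finset.sum_eq_zero
      intro π _
      rw [smul_eval, wheelCond_of_isWheel n _ (hwheel π) z i j k hij hjk h1 h2, mul_zero]
    have hsH : s.IsHomogeneous (n * (n - 1)) := by
      rw [hs]
      apply IsHomogeneous.sum
      intro π _
      rw [smul_eq_C_mul]
      exact (hwheel π).1.C_mul _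
    apply eq_zero_of_matchings n (Fin (2 * n)) (by simp)
    · intro z i j k hij hjk h1 h2
      rw [map_sub, hsW z i j k hij hjk h1 h2,
        wheelCond_of_isWheel n p hp z i j k hij hjk h1 h2, sub_zero]
    · exact (hp.1.sub hsH).totalDegree_le
    · intro f h1 h2 h3
      have h4 := hsum (fun π => evalNC p π) ⟨f, h1, h2, h3⟩
      rw [← hs] at h4
      rw [map_sub, sub_eq_zero]
      exact h4.symm
  · rw [Fintype.linearIndependent_iff]
    intro c hc σ
    rw [← hsum c σ, hc]
    simp [evalNC]
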